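/- There exists a group word w(x_1,x_2,x_3) in the free group F_3 on three generators such that the set of values Alt(13)_w of w in the alternating group Alt(13) consists exactly of the identity and all 3-cycles. -/

import Mathlib

/-- The set of values of a word `w ∈ F_d` in a group `G`:
`G_w = { w(g₁,…,g_d)^{±1} : gᵢ ∈ G }`. -/
def wordValues {d : ℕ} (w : FreeGroup (Fin d)) (G : Type*) [Group G] : Set G :=
  {g | ∃ f : Fin d → G, FreeGroup.lift f w = g ∨ FreeGroup.lift f w = g⁻¹}

theorem aux_prime {F G : Type*} [Group F] [Group G] [IsSimpleGroup G]
    (hG : ∃ a b : G, a * b ≠ b * a) (f : F →* G) (hf : Function.Surjective f)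
    (A B : Subgroup F) [hA : A.Normal] [hB : B.Normal] (h : A ⊓ B ≤ f.ker) :
    A ≤ f.ker ∨ B ≤ f.ker := by
  by_contra! hc
  obtain ⟨h1, h2⟩ := hc
  have key : ∀ C : Subgroup F, C.Normal → ¬ C ≤ f.ker → C.map f = ⊤ := by
    intro C hC hn
    have : (C.map f).Normal := hC.map f hf
    rcases this.eq_bot_or_eq_top with h | h
    · exact absurd ((Subgroup.map_eq_bot_iff C).1 h) hn
    · exact h
  obtain ⟨a, b, hab⟩ := hG
  have ha : a ∈ A.map f := by rw [key A hA h1]; trivial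
  have hb : b ∈ B.map f := by rw [key B hB h2]; trivial
  obtain ⟨x, hx, rfl⟩ := ha
  obtain ⟨y, hy, rfl⟩ := hb
  have hm : x * y * x⁻¹ * y⁻¹ ∈ A ⊓ B := by
    refine ⟨?_, ?_⟩
    · have := A.mul_mem hx (hA.conj_mem _ (A.inv_mem hx) y)
      simpa [mul_assoc] using this
    · exact B.mul_mem (hB.conj_mem _ hy x) (B.inv_mem hy)
  have := h hm
  rw [MonoidHom.mem_ker] at this
  apply hab
  simp only [map_mul, map_inv] at this
  rw [mul_inv_eq_one, mul_inv_eq_iff_eq_mul] at this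
  exact this

theorem aux_prime_finset {ι F G : Type*} [Group F] [Group G] [IsSimpleGroup G]
    (hG : ∃ a b : G, a * b ≠ b * a) (f : F →* G) (hf : Function.Surjective f)
    (N : ι → Subgroup F) (hN : ∀ i, (N i).Normal) (s : Finset ι) :
    (s.inf N).Normal ∧ (s.inf N ≤ f.ker → ∃ i ∈ s, N i ≤ f.ker) := by
  classical
  induction s using Finset.induction_on with
  | empty =>
    refine ⟨by rw [Finset.inf_empty]; infer_instance, fun h => ?_⟩
    exfalso
    rw [Finset.inf_empty] at h
    obtain ⟨a, b, hab⟩ := hG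
    obtain ⟨x, rfl⟩ := hf a
    have : f x = 1 := h (Subgroup.mem_top x)
    apply hab
    rw [this]; simp
  | insert i s hi ih =>
    rw [Finset.inf_insert]
    have h1 := hN i
    have h2 := ih.1
    refine ⟨inferInstance, fun h => ?_⟩
    rcases aux_prime hG f hf _ _ h with h | h
    · exact ⟨i, by simp, h⟩
    · obtain ⟨j, hj, h⟩ := ih.2 h
      exact ⟨j, by simp [hj], h⟩

theorem aux_word {d : ℕ} {G : Type*} [Group G] [Finite G] [IsSimpleGroup G]
    (hG : ∃ a b : G, a * b ≠ b * a) (f₀ : Fin d → G)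
    (hf : Function.Surjective (FreeGroup.lift f₀)) (c : G) :
    ∃ w : FreeGroup (Fin d), FreeGroup.lift f₀ w = c ∧
      ∀ f : Fin d → G, FreeGroup.lift f w = 1 ∨ ∃ φ : G ≃* G, FreeGroup.lift f w = φ c := by
  classical
  have := Fintype.ofFinite G
  let s : Finset (Fin d → G) :=
    Finset.univ.filter (fun f => ¬ (FreeGroup.lift f).ker ≤ (FreeGroup.lift f₀).ker)
  let N : (Fin d → G) → Subgroup (FreeGroup (Fin d)) := fun f => (FreeGroup.lift f).ker
  obtain ⟨hn, h⟩ := aux_prime_finset hG (FreeGroup.lift f₀) hf N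
    (fun i => MonoidHom.normal_ker _) s
  have hK : ¬ s.inf N ≤ (FreeGroup.lift f₀).ker := by
    intro h'
    obtain ⟨i, hi, hi'⟩ := h h'
    exact (Finset.mem_filter.1 hi).2 hi'
  have htop : (s.inf N).map (FreeGroup.lift f₀) = ⊤ := by
    have : ((s.inf N).map (FreeGroup.lift f₀)).Normal := hn.map _ hf
    rcases this.eq_bot_or_eq_top with h | h
    · exact absurd ((Subgroup.map_eq_bot_iff _).1 h) hK
    · exact h
  have hc : c ∈ (s.inf N).map (FreeGroup.lift f₀) := by rw [htop]; trivial
  obtain ⟨w, hw, hwc⟩ := hc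
  refine ⟨w, hwc, fun f => ?_⟩
  by_cases hfs : f ∈ s
  · left
    exact (Finset.inf_le hfs : s.inf N ≤ N f) hw
  · right
    have hle : (FreeGroup.lift f).ker ≤ (FreeGroup.lift f₀).ker := by
      by_contra h'
      exact hfs (Finset.mem_filter.2 ⟨Finset.mem_univ _, h'⟩)
    have hsurj : Function.Surjective (FreeGroup.lift f) := by
      rw [← MonoidHom.range_eq_top]
      apply Subgroup.eq_top_of_le_card
      have hd := Subgroup.index_dvd_of_le hle
      rw [Subgroup.index_ker, Subgroup.index_ker, MonoidHom.range_eq_top.2 hf,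
        Subgroup.card_top] at hd
      exact Nat.le_of_dvd Nat.card_pos hd
    let ψ : G →* G := (FreeGroup.lift f).liftOfSurjective hsurj ⟨FreeGroup.lift f₀, hle⟩
    have hψ : ∀ x, ψ (FreeGroup.lift f x) = FreeGroup.lift f₀ x := fun x =>
      MonoidHom.liftOfRightInverse_comp_apply _ _ _ _ x
    have hψs : Function.Surjective ψ := by
      intro y
      obtain ⟨x, rfl⟩ := hf y
      exact ⟨_, hψ x⟩
    have hψb : Function.Bijective ψ := ⟨Finite.injective_iff_surjective.2 hψs, hψs⟩
    refine ⟨(MulEquiv.ofBijective ψ hψb).symm, ?_⟩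
    rw [MulEquiv.eq_symm_apply]
    exact (hψ w).trans hwc

open Equiv Equiv.Perm in
theorem aux_gen : ∃ f : Fin 3 → alternatingGroup (Fin 13),
    Function.Surjective (FreeGroup.lift f) := by
  have h3 : IsThreeCycle (swap (0 : Fin 13) 1 * swap 0 2) :=
    isThreeCycle_swap_mul_swap_same (by decide) (by decide) (by decide)
  let a : alternatingGroup (Fin 13) := ⟨_, h3.mem_alternatingGroup⟩
  let b : alternatingGroup (Fin 13) :=
    ⟨finRotate 13, finRotate_bit1_mem_alternatingGroup (n := 6)⟩
  refine ⟨![a, b, 1], ?_⟩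
  rw [← MonoidHom.range_eq_top]
  set H := (FreeGroup.lift ![a, b, 1]).range with hH
  have ha : a ∈ H := ⟨FreeGroup.of 0, by simp⟩
  have hb : b ∈ H := ⟨FreeGroup.of 1, by simp⟩
  let K := H.map (alternatingGroup (Fin 13)).subtype
  have haK : (a : Perm (Fin 13)) ∈ K := ⟨a, ha, rfl⟩
  have hbK : finRotate 13 ∈ K := ⟨b, hb, rfl⟩
  have htr : MulAction.IsPretransitive K (Fin 13) := by
    have h0 : ∀ n : ℕ, ((finRotate 13) ^ n) (0 : Fin 13) = Fin.ofNat 13 n := by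
      intro n
      induction n with
      | zero => simp
      | succ n ih =>
        rw [pow_succ', Perm.mul_apply, ih, finRotate_apply]
        apply Fin.ext
        simp [Fin.val_add]
    rw [MulAction.isPretransitive_iff_base (0 : Fin 13)]
    intro y
    refine ⟨⟨(finRotate 13) ^ (y : ℕ), K.pow_mem hbK _⟩, ?_⟩
    change ((finRotate 13) ^ (y : ℕ)) (0 : Fin 13) = y
    rw [h0]; simp
  have hpr : MulAction.IsPreprimitive K (Fin 13) :=
    MulAction.IsPreprimitive.of_prime_card (by rw [Nat.card_fin]; norm_num)
  have hle := alternatingGroup_le_of_isPreprimitive_of_isThreeCycle_mem hpr h3 haK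
  rw [eq_top_iff]
  intro x _
  obtain ⟨y, hy, hyx⟩ := hle x.2
  have : y = x := Subtype.ext hyx
  exact this ▸ hy

open Equiv Equiv.Perm in
theorem aux_aut (φ : alternatingGroup (Fin 13) ≃* alternatingGroup (Fin 13))
    (c : alternatingGroup (Fin 13)) (hc : (c : Perm (Fin 13)).IsThreeCycle) :
    (φ c : Perm (Fin 13)).IsThreeCycle := by
  -- large centralizer
  have hcard : Nat.card (Subgroup.centralizer {(c : Perm (Fin 13))}) = 10886400 := by
    rw [nat_card_centralizer, hc.cycleType]
    simp [Nat.factorial]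
  have h1 : 10886400 ≤ 2 * Nat.card (Subgroup.centralizer {c}) := by
    let A := alternatingGroup (Fin 13)
    let C := Subgroup.centralizer {(c : Perm (Fin 13))}
    have e1 : Nat.card (A.subgroupOf C) * A.relIndex C = Nat.card C :=
      Subgroup.card_mul_index _
    have e2 : A.relIndex C ≤ 2 := by
      have : A.relIndex C ∣ A.index := Subgroup.relIndex_dvd_index_of_normal A C
      rw [alternatingGroup.index_eq_two] at this
      exact Nat.le_of_dvd (by norm_num) this
    have e3 : Nat.card (A.subgroupOf C) ≤ Nat.card (Subgroup.centralizer {c}) := by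
      let g : A.subgroupOf C → Subgroup.centralizer {c} := fun x =>
        ⟨⟨x.1.1, x.2⟩, by
          have := x.1.2
          rw [Subgroup.mem_centralizer_singleton_iff] at this ⊢
          exact Subtype.ext this⟩
      apply Nat.card_le_card_of_injective g
      intro x y hxy
      have : x.1.1 = y.1.1 := congrArg (fun z => z.1.1) hxy
      exact Subtype.ext (Subtype.ext this)
    change Nat.card C = _ at hcard
    rw [← hcard, ← e1]
    calc _ ≤ Nat.card (Subgroup.centralizer {c}) * 2 := Nat.mul_le_mul e3 e2
      _ = _ := mul_comm _ _
  have h2 : Nat.card (Subgroup.centralizer {c}) ≤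
      Nat.card (Subgroup.centralizer {(φ c : Perm (Fin 13))}) := by
    let g : Subgroup.centralizer {c} → Subgroup.centralizer {(φ c : Perm (Fin 13))} := fun x =>
      ⟨(φ x.1 : Perm (Fin 13)), by
        have := x.2
        rw [Subgroup.mem_centralizer_singleton_iff] at this ⊢
        have h := congrArg (fun z => (φ z : Perm (Fin 13))) this
        simpa using h⟩
    apply Nat.card_le_card_of_injective g
    intro x y hxy
    have : (φ x.1 : Perm (Fin 13)) = φ y.1 := congrArg (fun z => z.1) hxy
    exact Subtype.ext (φ.injective (Subtype.ext this))
  have ho : orderOf (φ c : Perm (Fin 13)) = 3 := by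
    rw [Subgroup.orderOf_coe, MulEquiv.orderOf_eq, ← Subgroup.orderOf_coe, hc.orderOf]
  have : Fact (Nat.Prime 3) := ⟨by norm_num⟩
  obtain ⟨n, hn⟩ := cycleType_prime_order (σ := (φ c : Perm (Fin 13))) (by rw [ho]; norm_num)
  rw [ho] at hn
  have hs := (φ c : Perm (Fin 13)).support.card_le_univ
  rw [← sum_cycleType, hn] at hs
  simp at hs
  have hn4 : n < 4 := by omega
  rw [nat_card_centralizer, hn] at h2
  rw [IsThreeCycle, hn]
  interval_cases n
  · rfl
  all_goals
    exfalso
    simp [Multiset.toFinset_replicate, Nat.factorial] at h2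
    omega

theorem stmt2 :
    ∃ w : FreeGroup (Fin 3),
      wordValues w (alternatingGroup (Fin 13)) =
        {g : alternatingGroup (Fin 13) | g = 1 ∨ (g : Equiv.Perm (Fin 13)).IsThreeCycle} := by
  have hS : IsSimpleGroup (alternatingGroup (Fin 13)) := alternatingGroup.isSimpleGroup (by simp)
  have hG : ∃ a b : alternatingGroup (Fin 13), a * b ≠ b * a := by
    by_contra! h
    have := alternatingGroup.center_eq_bot (α := Fin 13) (by simp)
    have h' : Subgroup.center (alternatingGroup (Fin 13)) = ⊤ := by
      rw [eq_top_iff]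
      intro x _
      rw [Subgroup.mem_center_iff]
      exact fun g => h g x
    exact bot_ne_top (this.symm.trans h')
  have h3 : Equiv.Perm.IsThreeCycle (Equiv.swap (0 : Fin 13) 1 * Equiv.swap 0 2) :=
    Equiv.Perm.isThreeCycle_swap_mul_swap_same (by decide) (by decide) (by decide)
  let c : alternatingGroup (Fin 13) := ⟨_, h3.mem_alternatingGroup⟩
  obtain ⟨f₀, hf⟩ := aux_gen
  obtain ⟨w, hw, hall⟩ := aux_word hG f₀ hf c
  refine ⟨w, Set.ext fun g => ⟨?_, ?_⟩⟩
  · have key : ∀ f : Fin 3 → alternatingGroup (Fin 13), FreeGroup.lift f w = 1 ∨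
        (FreeGroup.lift f w : Equiv.Perm (Fin 13)).IsThreeCycle := by
      intro f
      rcases hall f with h | ⟨φ, h⟩
      · exact Or.inl h
      · right; rw [h]; exact aux_aut φ c h3
    rintro ⟨f, h | h⟩
    · rw [← h]; exact key f
    · rcases key f with h' | h'
      · left; rw [h] at h'; exact inv_eq_one.1 h'
      · right; rw [h] at h'; simpa using h'.inv
  · rintro (h | h)
    · exact ⟨fun _ => 1, Or.inl (by
        rw [h]
        have : FreeGroup.lift (fun _ : Fin 3 => (1 : alternatingGroup (Fin 13))) = 1 := by
          ext; simp
        rw [this]; rfl)⟩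
    · obtain ⟨x, hx⟩ := isConj_iff.1
        (alternatingGroup.isThreeCycle_isConj (by simp) (show c.1.IsThreeCycle from h3) h)
      refine ⟨fun i => x * f₀ i * x⁻¹, Or.inl ?_⟩
      have : FreeGroup.lift (fun i => x * f₀ i * x⁻¹) =
          (MulAut.conj x).toMonoidHom.comp (FreeGroup.lift f₀) := by
        apply FreeGroup.ext_hom
        intro i
        simp
      rw [this, MonoidHom.comp_apply, hw]
      exact hx
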